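/- Let (Z,d_Z) be a bounded metric space with at least two points and let k > 0. Then LPM_k(Z,d_Z) ∩ AM(Z) is dense in \overline{LPM}_k(Z,d_Z) with respect to the sup-metric. -/

import Mathlib

open Set Filter

namespace BanachStone

/-- `d` is a pseudometric. -/
def IsPseudometric {Z : Type*} (d : Z → Z → ℝ) : Prop :=
  (∀ z, d z z = 0) ∧ (∀ z w, d z w = d w z) ∧ (∀ z w v, d z v ≤ d z w + d w v)

/-- `d` is bounded. -/
def IsBoundedPM {Z : Type*} (d : Z → Z → ℝ) : Prop := ∃ C : ℝ, ∀ z w, d z w ≤ C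

/-- The sup-norm of `d`. -/
noncomputable def supNorm {Z : Type*} (d : Z → Z → ℝ) : ℝ := ⨆ p : Z × Z, d p.1 p.2

/-- The sup-metric between `d` and `ρ`. -/
noncomputable def supDist {Z : Type*} (d ρ : Z → Z → ℝ) : ℝ :=
  ⨆ p : Z × Z, |d p.1 p.2 - ρ p.1 p.2|

/-- `PM Z`: bounded continuous pseudometrics on `Z`. -/
def PM (Z : Type*) [TopologicalSpace Z] : Set (Z → Z → ℝ) :=
  {d | IsPseudometric d ∧ IsBoundedPM d ∧ Continuous fun p : Z × Z => d p.1 p.2}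

/-- The topology induced by `d` (generated by open `d`-balls). -/
def metricTopology {Z : Type*} (d : Z → Z → ℝ) : TopologicalSpace Z :=
  TopologicalSpace.generateFrom {s | ∃ z : Z, ∃ r : ℝ, s = {w | d z w < r}}

/-- `AM Z`: admissible metrics, i.e. bounded metrics inducing the topology of `Z`. -/
def AM (Z : Type*) [t : TopologicalSpace Z] : Set (Z → Z → ℝ) :=
  {d | IsPseudometric d ∧ IsBoundedPM d ∧ (∀ z w : Z, z ≠ w → 0 < d z w) ∧
    metricTopology d = t}

/-- `Pp Z`: elements of `PM Z` attaining the sup-norm at exactly one unordered pair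
of distinct points. -/
def Pp (Z : Type*) [TopologicalSpace Z] : Set (Z → Z → ℝ) :=
  {d | d ∈ PM Z ∧ ∃ z w : Z, z ≠ w ∧ d z w = supNorm d ∧
    ∀ z' w' : Z, z' ≠ w' → d z' w' = supNorm d → ({z', w'} : Set Z) = {z, w}}

/-- `UPM Z`: bounded pseudometrics uniformly continuous w.r.t. the uniformity of `Z`. -/
def UPM (Z : Type*) [UniformSpace Z] : Set (Z → Z → ℝ) :=
  {d | IsPseudometric d ∧ IsBoundedPM d ∧
    ∀ ε : ℝ, 0 < ε → ∃ U ∈ uniformity Z, ∀ x y : Z, (x, y) ∈ U → d x y < ε}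

/-- `UC Z`: bounded uniformly continuous real-valued functions on `Z`. -/
def UC (Z : Type*) [UniformSpace Z] : Set (Z → ℝ) :=
  {f | (∃ C : ℝ, ∀ z, |f z| ≤ C) ∧ UniformContinuous f}

/-- The space `U(Z)`. -/
def Ucal (Z : Type*) [UniformSpace Z] : Set (Z → Z → ℝ) :=
  {d | d ∈ PM Z ∧ ∀ ε : ℝ, 0 < ε → ∃ F : Finset (Z → ℝ), F.Nonempty ∧
    (↑F : Set (Z → ℝ)) ⊆ UC Z ∧ ∃ δ : ℝ, 0 < δ ∧
    ∀ x y : Z, (∀ f ∈ F, |f x - f y| < δ) → d x y < ε}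

/-- The uniformity filter of the coarsest uniformity on `Z` making every bounded
uniformly continuous real-valued function on `Z` uniformly continuous. -/
noncomputable def U0 (Z : Type*) [UniformSpace Z] : Filter (Z × Z) :=
  ⨅ f ∈ UC Z, Filter.comap (fun p : Z × Z => (f p.1, f p.2)) (uniformity ℝ)

/-- The Lipschitz constant of a pseudometric on a metric space. -/
noncomputable def lip {Z : Type*} [PseudoMetricSpace Z] (d : Z → Z → ℝ) : ENNReal :=
  ⨆ (x : Z) (y : Z) (_ : x ≠ y), ENNReal.ofReal (d x y / dist x y)

/-- `LPM Z`: bounded Lipschitz continuous pseudometrics on `Z`. -/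
def LPM (Z : Type*) [MetricSpace Z] : Set (Z → Z → ℝ) :=
  {d | IsPseudometric d ∧ IsBoundedPM d ∧ lip d < ⊤}

/-- `LPM_k Z`: elements of `LPM Z` with Lipschitz constant `< k`. -/
def LPMlt (k : ℝ) (Z : Type*) [MetricSpace Z] : Set (Z → Z → ℝ) :=
  {d | d ∈ LPM Z ∧ lip d < ENNReal.ofReal k}

/-- `\overline{LPM}_k Z`: elements of `LPM Z` with Lipschitz constant `≤ k`. -/
def LPMle (k : ℝ) (Z : Type*) [MetricSpace Z] : Set (Z → Z → ℝ) :=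
  {d | d ∈ LPM Z ∧ lip d ≤ ENNReal.ofReal k}

/-- `Z` has exactly two points. -/
def ExactlyTwo (Z : Type*) : Prop := ∃ a b : Z, a ≠ b ∧ ∀ c : Z, c = a ∨ c = b

/-- The two-element subsets of `Z`. -/
def Dset (Z : Type*) : Set (Set Z) := {s | ∃ a b : Z, a ≠ b ∧ s = {a, b}}

/-- Distances of a pseudometric are nonnegative. -/
theorem IsPseudometric.nonneg {Z : Type*} {d : Z → Z → ℝ} (hd : IsPseudometric d) (x y : Z) :
    0 ≤ d x y := by
  have h := hd.2.2 x y x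
  rw [hd.1 x, hd.2.1 y x] at h
  linarith

/-- A bound on the Lipschitz constant is a pointwise bound. -/
theorem le_mul_dist_of_lip_le {Z : Type*} [MetricSpace Z] {d : Z → Z → ℝ}
    (hd : IsPseudometric d) {k : ℝ} (hk : 0 ≤ k) (h : lip d ≤ ENNReal.ofReal k) (x y : Z) :
    d x y ≤ k * dist x y := by
  rcases eq_or_ne x y with rfl | hxy
  · simp [hd.1 x]
  · have hle : ENNReal.ofReal (d x y / dist x y) ≤ ENNReal.ofReal k :=
      (le_iSup₂_of_le x y
        (le_iSup (fun _ : x ≠ y => ENNReal.ofReal (d x y / dist x y)) hxy)).trans h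
    exact (div_le_iff₀ (dist_pos.2 hxy)).1 ((ENNReal.ofReal_le_ofReal_iff hk).1 hle)

/-- A pointwise bound is a bound on the Lipschitz constant. -/
theorem lip_le_of_le_mul_dist {Z : Type*} [MetricSpace Z] {d : Z → Z → ℝ} {k : ℝ}
    (h : ∀ x y, d x y ≤ k * dist x y) : lip d ≤ ENNReal.ofReal k :=
  iSup₂_le fun x y => iSup_le fun hxy =>
    ENNReal.ofReal_le_ofReal ((div_le_iff₀ (dist_pos.2 hxy)).2 (h x y))

/-- A pseudometric bi-Lipschitz equivalent to the given metric induces its topology. -/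
theorem metricTopology_eq_of_biLipschitz {Z : Type*} [t : MetricSpace Z] {d : Z → Z → ℝ}
    (hd : IsPseudometric d) {c k : ℝ} (hc : 0 < c) (hk : 0 < k)
    (hlow : ∀ x y, c * dist x y ≤ d x y) (hup : ∀ x y, d x y ≤ k * dist x y) :
    metricTopology d = t.toUniformSpace.toTopologicalSpace := by
  apply le_antisymm
  · intro s hs
    rw [Metric.isOpen_iff] at hs
    refine (@isOpen_iff_forall_mem_open Z (metricTopology d) s).2 fun x hx => ?_
    obtain ⟨r, hr, hball⟩ := hs x hx
    refine ⟨{w | d x w < c * r}, fun w hw => hball ?_,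
      TopologicalSpace.isOpen_generateFrom_of_mem ⟨x, c * r, rfl⟩, ?_⟩
    · rw [Metric.mem_ball, dist_comm]
      exact lt_of_mul_lt_mul_left ((hlow x w).trans_lt hw) hc.le
    · change d x x < c * r
      rw [hd.1 x]
      positivity
  · refine le_generateFrom ?_
    rintro _ ⟨z, r, rfl⟩
    refine Metric.isOpen_iff.2 fun x (hx : d z x < r) => ?_
    refine ⟨(r - d z x) / k, div_pos (sub_pos.2 hx) hk, fun w hw => ?_⟩
    rw [Metric.mem_ball, dist_comm, lt_div_iff₀ hk] at hw
    change d z w < r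
    linarith [hd.2.2 z x w, hup x w]

theorem stmt18 {Z : Type*} [MetricSpace Z] [Nontrivial Z]
    (hZ : ∃ C : ℝ, ∀ a b : Z, dist a b ≤ C) (k : ℝ) (hk : 0 < k) :
    ∀ d ∈ LPMle k Z, ∀ ε : ℝ, 0 < ε →
      ∃ ρ ∈ LPMlt k Z ∩ AM Z, supDist d ρ < ε := by
  rintro d ⟨⟨hd, -, -⟩, hlip⟩ ε hε
  obtain ⟨C, hC⟩ := hZ
  obtain ⟨a, b, hab⟩ := exists_pair_ne Z
  have hC0 : 0 < C := (dist_pos.2 hab).trans_le (hC a b)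
  have hdk := le_mul_dist_of_lip_le hd hk.le hlip
  obtain ⟨s, hs0, hs1, hsε⟩ : ∃ s : ℝ, 0 < s ∧ s < 1 ∧ s * (k * C) ≤ ε := by
    refine ⟨min (1 / 2) (ε / (k * C)), by positivity,
      (min_le_left _ _).trans_lt (by norm_num), ?_⟩
    exact (le_div_iff₀ (by positivity)).1 (min_le_right _ _)
  set ρ : Z → Z → ℝ := fun x y => (1 - s) * d x y + s * (k / 2 * dist x y) with hρdef
  have hρ : IsPseudometric ρ := by
    refine ⟨fun z => by simp [hρdef, hd.1 z], fun z w => ?_, fun z w v => ?_⟩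
    · simp only [hρdef, hd.2.1 z w, dist_comm z w]
    · have h₁ := mul_le_mul_of_nonneg_left (hd.2.2 z w v) (sub_pos.2 hs1).le
      have h₂ := mul_le_mul_of_nonneg_left (dist_triangle z w v)
        (show 0 ≤ s * (k / 2) by positivity)
      simp only [hρdef]
      linarith
  have hlow : ∀ x y, s * (k / 2) * dist x y ≤ ρ x y := fun x y => by
    have := mul_nonneg (sub_pos.2 hs1).le (hd.nonneg x y)
    simp only [hρdef]
    linarith
  have hup : ∀ x y, ρ x y ≤ k * (1 - s / 2) * dist x y := fun x y => by
    have := mul_le_mul_of_nonneg_left (hdk x y) (sub_pos.2 hs1).le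
    simp only [hρdef]
    linarith
  have hk' : 0 < k * (1 - s / 2) := mul_pos hk (by linarith)
  have hbdd : IsBoundedPM ρ :=
    ⟨k * (1 - s / 2) * C, fun z w =>
      (hup z w).trans (mul_le_mul_of_nonneg_left (hC z w) hk'.le)⟩
  have hρlip := lip_le_of_le_mul_dist hup
  have hlt : lip ρ < ENNReal.ofReal k :=
    hρlip.trans_lt ((ENNReal.ofReal_lt_ofReal_iff hk).2 (by nlinarith))
  have hc : 0 < s * (k / 2) := by positivity
  refine ⟨ρ, ⟨⟨⟨hρ, hbdd, hlt.trans ENNReal.ofReal_lt_top⟩, hlt⟩, hρ, hbdd,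
    fun z w hzw => (mul_pos hc (dist_pos.2 hzw)).trans_le (hlow z w),
    metricTopology_eq_of_biLipschitz hρ hc hk' hlow hup⟩, ?_⟩
  have : Nonempty (Z × Z) := ⟨(a, b)⟩
  refine (ciSup_le fun p => ?_ : supDist d ρ ≤ ε / 2).trans_lt (half_lt_self hε)
  obtain ⟨x, y⟩ := p
  have hdiff : d x y - ρ x y = s * (d x y - k / 2 * dist x y) := by
    simp only [hρdef]
    ring
  have habs : |d x y - k / 2 * dist x y| ≤ k / 2 * C := by
    have := mul_le_mul_of_nonneg_left (hC x y) hk.le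
    rw [abs_le]
    constructor <;> linarith [hd.nonneg x y, hdk x y]
  change |d x y - ρ x y| ≤ ε / 2
  rw [hdiff, abs_mul, abs_of_pos hs0]
  linarith [mul_le_mul_of_nonneg_left habs hs0.le]

end BanachStone
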